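/- arXiv:2103.11449 — 2 statements merged into one kernel-verified Lean document; each statement's English description precedes it below -/
import Mathlib

section
/- Let A be an associative unital algebra over ℂ, let ω be a nonzero complex number, and let e_1,…,e_d ∈ A satisfy e_i e_j = ω e_j e_i for all 1 ≤ i < j ≤ d and T(e_i,e_j,e_k) = 0 for all 1 ≤ i ≤ j ≤ k ≤ d, where T(a,b,c) := abc + acb + bac + bca + cab + cba. Then (i) e_i³ = 0 for every i = 1,…,d, and (ii) if in addition e_j e_i² ≠ 0 for some pair i < j, then 1 + ω + ω² = 0; in particular ω³ = 1 and ω ≠ 1. -/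
/-- In an associative unital ℂ-algebra `A`, if elements `e 1, …, e d`
satisfy `e i * e j = ω • (e j * e i)` for `i < j` (with `ω ≠ 0`) and the ternary form
`T(eᵢ,eⱼ,eₖ) = eᵢeⱼeₖ + eᵢeₖeⱼ + eⱼeᵢeₖ + eⱼeₖeᵢ + eₖeᵢeⱼ + eₖeⱼeᵢ` vanishes for all
`i ≤ j ≤ k`, then (i) `eᵢ³ = 0` for every `i`, and (ii) if moreover `e j * e i ^ 2 ≠ 0`
for some `i < j`, then `1 + ω + ω² = 0`; in particular `ω³ = 1` and `ω ≠ 1`. -/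
theorem ternary_relations_force_cube_zero_and_omega_root
    (A : Type*) [Ring A] [Algebra ℂ A] (ω : ℂ) (hω : ω ≠ 0)
    (d : ℕ) (e : Fin d → A)
    (hcomm : ∀ i j : Fin d, i < j → e i * e j = ω • (e j * e i))
    (hT : ∀ i j k : Fin d, i ≤ j → j ≤ k →
      e i * e j * e k + e i * e k * e j + e j * e i * e k
        + e j * e k * e i + e k * e i * e j + e k * e j * e i = 0) :
    (∀ i : Fin d, e i ^ 3 = 0) ∧
      ((∃ i j : Fin d, i < j ∧ e j * e i ^ 2 ≠ 0) →
        1 + ω + ω ^ 2 = 0 ∧ ω ^ 3 = 1 ∧ ω ≠ 1) := by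
  refine ⟨fun i => ?_, ?_⟩
  · have h := hT i i i le_rfl le_rfl
    have h6 : (6 : ℂ) • e i ^ 3 = 0 := by
      rw [← h, show (6 : ℂ) = 1 + 1 + 1 + 1 + 1 + 1 by norm_num]
      simp only [add_smul, one_smul, pow_succ, pow_zero, one_mul]
    exact (smul_eq_zero_iff_right (by norm_num)).1 h6
  · rintro ⟨i, j, hij, hne⟩
    have hc := hcomm i j hij
    have h_iji : e i * e j * e i = ω • (e j * e i ^ 2) := by
      rw [hc, smul_mul_assoc, mul_assoc, sq]
    have h_iij : e i * e i * e j = ω ^ 2 • (e j * e i ^ 2) := by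
      rw [mul_assoc, hc, mul_smul_comm, ← mul_assoc, h_iji, smul_smul, ← sq ω]
    have h_jii : e j * e i * e i = e j * e i ^ 2 := by rw [mul_assoc, sq]
    have h := hT i i j le_rfl hij.le
    rw [h_iji, h_iij, h_jii] at h
    have h2 : (2 * (1 + ω + ω ^ 2)) • (e j * e i ^ 2) = 0 := by
      rw [← h]
      module
    have hroot : 1 + ω + ω ^ 2 = 0 := by
      simpa using (smul_eq_zero_iff_left hne).1 h2
    refine ⟨hroot, by linear_combination (ω - 1) * hroot, ?_⟩
    rintro rfl
    norm_num at hroot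
end

section
/- Every grade-one element z = z_1 e_1 + ⋯ + z_d e_d ∈ [G_{3,d}]_1 (with z_1,…,z_d ∈ ℂ) satisfies z³ = 0. -/
noncomputable section

open Finset

namespace TG3

/-- The primitive third root of unity `ω = exp(2πi/3)`. -/
noncomputable def omg : ℂ := Complex.exp (2 * Real.pi * Complex.I / 3)

/-- Multi-indices `ν ∈ I_d = {0,1,2}^d`. -/
abbrev Idx (d : ℕ) := Fin d → Fin 3

/-- `|ν| = ν₁ + ⋯ + ν_d`. -/
def degree {d : ℕ} (ν : Idx d) : ℕ := ∑ j, (ν j).val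

/-- `σ(ν,μ) = ω^(2 ∑_{s<j} ν_j μ_s)` if `ν_j + μ_j ≤ 2` for all `j`, and `0` otherwise. -/
noncomputable def sigma {d : ℕ} (ν μ : Idx d) : ℂ :=
  if ∀ j, (ν j).val + (μ j).val ≤ 2 then
    omg ^ (2 * ∑ s : Fin d, ∑ j : Fin d, if s < j then (ν j).val * (μ s).val else 0)
  else 0

/-- Elements of the ternary Grassmann algebra `G_{3,d}`, recorded by their
coefficients `z ν` on the basis `e^ν`. -/
abbrev G (d : ℕ) := Idx d → ℂ

/-- The product of `G_{3,d}`, determined by `e^ν e^μ = σ(ν,μ) e^{ν+μ}`. -/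
noncomputable def gmul {d : ℕ} (z w : G d) : G d := fun γ =>
  ∑ ν : Idx d, ∑ μ : Idx d,
    if (∀ j, (ν j).val + (μ j).val = (γ j).val) then sigma ν μ * z ν * w μ else 0

/-- The unit `1 = e^{(0,…,0)}`. -/
noncomputable def gone (d : ℕ) : G d := fun ν => if ν = 0 then 1 else 0

/-- The `i`-th standard unit multi-index. -/
def unitIdx {d : ℕ} (i : Fin d) : Idx d := fun j => if j = i then 1 else 0

/-- The generator `e_i` as an element of `G_{3,d}`. -/
noncomputable def eVec {d : ℕ} (i : Fin d) : G d := fun ν => if ν = unitIdx i then 1 else 0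

lemma val_unitIdx {d : ℕ} (i l : Fin d) : (unitIdx i l).val = if l = i then 1 else 0 := by
  unfold unitIdx
  split_ifs <;> rfl

lemma omg_sq_sum : 1 + omg ^ 2 + omg ^ 4 = 0 := by
  have h : IsPrimitiveRoot omg 3 := by
    simpa [omg] using Complex.isPrimitiveRoot_exp 3 (by norm_num)
  have h1 : 1 + omg + omg ^ 2 = 0 := by
    simpa [Finset.sum_range_succ] using h.geom_sum_eq_zero (by norm_num)
  linear_combination (1 - omg + omg ^ 2) * h1

/-- Multiplication in `G_{3,d}` as a bilinear map. -/
noncomputable def gmulBilin (d : ℕ) : G d →ₗ[ℂ] G d →ₗ[ℂ] G d :=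
  LinearMap.mk₂ ℂ gmul
    (fun x y w => by
      funext γ
      simp only [gmul, Pi.add_apply, ← Finset.sum_add_distrib]
      refine sum_congr rfl fun ν _ => sum_congr rfl fun μ _ => ?_
      split_ifs <;> ring)
    (fun a x w => by
      funext γ
      simp only [gmul, Pi.smul_apply, smul_eq_mul, Finset.mul_sum]
      refine sum_congr rfl fun ν _ => sum_congr rfl fun μ _ => ?_
      split_ifs <;> ring)
    (fun x y w => by
      funext γ
      simp only [gmul, Pi.add_apply, ← Finset.sum_add_distrib]
      refine sum_congr rfl fun ν _ => sum_congr rfl fun μ _ => ?_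
      split_ifs <;> ring)
    (fun a x w => by
      funext γ
      simp only [gmul, Pi.smul_apply, smul_eq_mul, Finset.mul_sum]
      refine sum_congr rfl fun ν _ => sum_congr rfl fun μ _ => ?_
      split_ifs <;> ring)

lemma gmulBilin_apply {d : ℕ} (z w : G d) : gmulBilin d z w = gmul z w := rfl

lemma gmul_eVec_right {d : ℕ} (z : G d) (k : Fin d) (γ : Idx d) :
    gmul z (eVec k) γ = ∑ ν : Idx d,
      if ∀ l, (ν l).val + (unitIdx k l).val = (γ l).val then sigma ν (unitIdx k) * z ν else 0 := by
  refine sum_congr rfl fun ν _ => ?_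
  rw [Finset.sum_eq_single (unitIdx k)]
  · simp [eVec]
  · intro μ _ h
    simp [eVec, h]
  · simp

lemma sigma_unitIdx_right {d : ℕ} (ν : Idx d) (k : Fin d)
    (h : ∀ l, (ν l).val + (unitIdx k l).val ≤ 2) :
    sigma ν (unitIdx k) = omg ^ (2 * ∑ l : Fin d, if k < l then (ν l).val else 0) := by
  rw [sigma, if_pos h, Finset.sum_eq_single k]
  · simp [val_unitIdx]
  · intro s _ hs
    simp [val_unitIdx, hs]
  · simp

lemma val_unitIdx_add {d : ℕ} (i j l : Fin d) :
    ((unitIdx i + unitIdx j : Idx d) l).val = (unitIdx i l).val + (unitIdx j l).val := by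
  simp only [Pi.add_apply, unitIdx]
  split_ifs <;> rfl

lemma gmul_eVec_eVec {d : ℕ} (i j : Fin d) (ν : Idx d) :
    gmul (eVec i) (eVec j) ν =
      if ν = unitIdx i + unitIdx j then omg ^ (2 * if j < i then 1 else 0) else 0 := by
  rw [gmul_eVec_right, Finset.sum_eq_single (unitIdx i)]
  · have hiff : (∀ l, (unitIdx i l).val + (unitIdx j l).val = (ν l).val) ↔
        ν = unitIdx i + unitIdx j := by
      simp only [← val_unitIdx_add, funext_iff, Fin.ext_iff, eq_comm]
    have hle : ∀ l, (unitIdx i l).val + (unitIdx j l).val ≤ 2 := fun l => by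
      simp only [val_unitIdx]
      split_ifs <;> omega
    simp only [hiff]
    rw [sigma_unitIdx_right _ _ hle, Finset.sum_eq_single i]
    · simp [val_unitIdx, eVec]
    · intro l _ hl
      simp [val_unitIdx, hl]
    · simp
  · intro μ _ h
    simp [eVec, h]
  · simp

lemma gmul_eVec_eVec_eVec {d : ℕ} (i j k : Fin d) (γ : Idx d) :
    gmul (gmul (eVec i) (eVec j)) (eVec k) γ =
      if ∀ l, (unitIdx i l).val + (unitIdx j l).val + (unitIdx k l).val = (γ l).val then
        omg ^ (2 * ((if j < i then 1 else 0) + (if k < i then 1 else 0) + if k < j then 1 else 0))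
      else 0 := by
  rw [gmul_eVec_right, Finset.sum_eq_single (unitIdx i + unitIdx j)]
  · simp only [val_unitIdx_add]
    refine if_ctx_congr Iff.rfl (fun h => ?_) fun _ => rfl
    have hsum (a : Fin d) : (∑ l, if k < l then (unitIdx a l).val else 0) =
        if k < a then 1 else 0 := by
      rw [Finset.sum_eq_single a]
      · simp [val_unitIdx]
      · intro l _ hl
        simp [val_unitIdx, hl]
      · simp
    have hsplit : (∑ l, if k < l then ((unitIdx i + unitIdx j : Idx d) l).val else 0) =
        (if k < i then 1 else 0) + if k < j then 1 else 0 := by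
      rw [← hsum i, ← hsum j, ← Finset.sum_add_distrib]
      refine sum_congr rfl fun l _ => ?_
      rw [val_unitIdx_add]
      split_ifs <;> rfl
    rw [sigma_unitIdx_right, hsplit, gmul_eVec_eVec, if_pos rfl, ← pow_add]
    · congr 1
      ring
    · intro l
      rw [val_unitIdx_add, h l]
      omega
  · intro ν _ h
    simp [gmul_eVec_eVec, h]
  · simp

lemma symmetrized_eVec_product {d : ℕ} (i j k : Fin d) :
    gmul (gmul (eVec i) (eVec j)) (eVec k) + gmul (gmul (eVec i) (eVec k)) (eVec j) +
    gmul (gmul (eVec j) (eVec i)) (eVec k) + gmul (gmul (eVec j) (eVec k)) (eVec i) +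
    gmul (gmul (eVec k) (eVec i)) (eVec j) + gmul (gmul (eVec k) (eVec j)) (eVec i) = 0 := by
  funext γ
  simp only [Pi.add_apply, Pi.zero_apply, gmul_eVec_eVec_eVec]
  by_cases h : ∀ l, (unitIdx i l).val + (unitIdx j l).val + (unitIdx k l).val = (γ l).val
  · have hne : ¬ (i = j ∧ j = k) := by
      rintro ⟨rfl, rfl⟩
      have := h i
      simp only [val_unitIdx, if_true] at this
      omega
    have h2 : ∀ l, (unitIdx i l).val + (unitIdx k l).val + (unitIdx j l).val = (γ l).val :=
      fun l => by have := h l; omega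
    have h3 : ∀ l, (unitIdx j l).val + (unitIdx i l).val + (unitIdx k l).val = (γ l).val :=
      fun l => by have := h l; omega
    have h4 : ∀ l, (unitIdx j l).val + (unitIdx k l).val + (unitIdx i l).val = (γ l).val :=
      fun l => by have := h l; omega
    have h5 : ∀ l, (unitIdx k l).val + (unitIdx i l).val + (unitIdx j l).val = (γ l).val :=
      fun l => by have := h l; omega
    have h6 : ∀ l, (unitIdx k l).val + (unitIdx j l).val + (unitIdx i l).val = (γ l).val :=
      fun l => by have := h l; omega
    rw [if_pos h, if_pos h2, if_pos h3, if_pos h4, if_pos h5, if_pos h6]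
    have hq := omg_sq_sum
    split_ifs <;> first
      | (exfalso; omega)
      | linear_combination (1 + omg ^ 2) * hq
      | linear_combination 2 * hq
  · have h2 : ¬ ∀ l, (unitIdx i l).val + (unitIdx k l).val + (unitIdx j l).val = (γ l).val :=
      fun h' => h fun l => by have := h' l; omega
    have h3 : ¬ ∀ l, (unitIdx j l).val + (unitIdx i l).val + (unitIdx k l).val = (γ l).val :=
      fun h' => h fun l => by have := h' l; omega
    have h4 : ¬ ∀ l, (unitIdx j l).val + (unitIdx k l).val + (unitIdx i l).val = (γ l).val :=
      fun h' => h fun l => by have := h' l; omega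
    have h5 : ¬ ∀ l, (unitIdx k l).val + (unitIdx i l).val + (unitIdx j l).val = (γ l).val :=
      fun h' => h fun l => by have := h' l; omega
    have h6 : ¬ ∀ l, (unitIdx k l).val + (unitIdx j l).val + (unitIdx i l).val = (γ l).val :=
      fun h' => h fun l => by have := h' l; omega
    simp only [if_neg h, if_neg h2, if_neg h3, if_neg h4, if_neg h5, if_neg h6, add_zero]

/-- A triple sum vanishes if the symmetrization of its summand does. -/
lemma sum_eq_zero_of_symmetrized {ι M : Type*} [Fintype ι] [AddCommGroup M] [Module ℂ M]
    (f : ι → ι → ι → M)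
    (hf : ∀ i j k, f i j k + f i k j + f j i k + f j k i + f k i j + f k j i = 0) :
    ∑ i, ∑ j, ∑ k, f i j k = 0 := by
  have swap (g : ι → ι → ι → M) : ∑ i, ∑ j, ∑ k, g j i k = ∑ i, ∑ j, ∑ k, g i j k :=
    Finset.sum_comm
  have swap' (g : ι → ι → ι → M) : ∑ i, ∑ j, ∑ k, g i k j = ∑ i, ∑ j, ∑ k, g i j k :=
    sum_congr rfl fun _ _ => Finset.sum_comm
  have h : ∑ i, ∑ j, ∑ k, (f i j k + f i k j + f j i k + f j k i + f k i j + f k j i) = 0 := by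
    simp only [hf, Finset.sum_const_zero]
  simp only [Finset.sum_add_distrib] at h
  have cyc : ∑ i, ∑ j, ∑ k, f j k i = ∑ i, ∑ j, ∑ k, f i j k :=
    (swap fun i j k => f i k j).trans (swap' f)
  have cyc' : ∑ i, ∑ j, ∑ k, f k i j = ∑ i, ∑ j, ∑ k, f i j k :=
    (swap' fun i j k => f j i k).trans (swap f)
  have rev : ∑ i, ∑ j, ∑ k, f k j i = ∑ i, ∑ j, ∑ k, f i j k :=
    (swap fun i j k => f k i j).trans cyc'
  rw [swap' f, swap f, cyc, cyc', rev] at h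
  have h6 : (6 : ℂ) • ∑ i, ∑ j, ∑ k, f i j k = 0 := by
    rw [← h]
    module
  exact (smul_eq_zero.mp h6).resolve_left (by norm_num)

/-- every grade-one element `z = z₁ e₁ + ⋯ + z_d e_d` of `G_{3,d}`
satisfies `z³ = 0`. -/
theorem grade_one_cube_zero (d : ℕ) (c : Fin d → ℂ) :
    gmul (gmul (∑ i, c i • eVec i) (∑ i, c i • eVec i)) (∑ i, c i • eVec i) = 0 := by
  simp only [← gmulBilin_apply, map_sum, map_smul, LinearMap.sum_apply, LinearMap.smul_apply,
    Finset.smul_sum, smul_smul]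
  refine sum_eq_zero_of_symmetrized _ fun i j k => ?_
  simp only [gmulBilin_apply]
  have h := congrArg ((c i * c j * c k) • ·) (symmetrized_eVec_product i j k)
  simp only [smul_zero] at h
  rw [← h]
  module

end TG3
end
end
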